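/- Let p, q be probability distributions with V(p) > 0 and V(q) > 0, and let f be a probability distribution that is either sharp or uniform, with H(f) ≠ H(p), H(f) ≠ H(q) and (H(f) − H(p))/(H(f) − H(q)) > 0. Let (t_n) be a moderate sequence, fix μ ∈ ℝ, set r_n(μ) = (H(f) − H(p) + μ t_n)/(H(f) − H(q)), m_n = ⌊n·r_n(μ)⌋, P^n = p^{⊗n} ⊗ f^{⊗m_n}, Q^n = q^{⊗m_n} ⊗ f^{⊗n}, K_n(x) = exp( H(Q^n) + x·n·t_n ) = exp( m_n H(q) + n H(f) + x·n·t_n ), and ν = (V(p)/V(q))·(H(f) − H(q))/(H(f) − H(p)). Then: (i) for x ≤ 0, lim_{n→∞} (1/(n t_n²)) ln[ ∑_{i ≤ K_n(x)} (Q^n)^↓_i ] = −ν x²/(2 V(p)); (ii) for x ≥ 0, lim_{n→∞} (1/(n t_n²)) ln[ ∑_{i ≥ K_n(x)} (Q^n)^↓_i ] = −ν x²/(2 V(p)); (iii) for x ≤ μ, lim_{n→∞} (1/(n t_n²)) ln[ ∑_{i ≤ K_n(x)} (P^n)^↓_i ] = −(x − μ)²/(2 V(p)); (iv) for x ≥ μ,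 lim_{n→∞} (1/(n t_n²)) ln[ ∑_{i ≥ K_n(x)} (P^n)^↓_i ] = −(x − μ)²/(2 V(p)). -/

import Mathlib

open Finset Filter Real Topology

noncomputable section

/-- A probability distribution on a finite type: nonnegative entries summing to 1. -/
def IsProbDist {α : Type*} [Fintype α] (a : α → ℝ) : Prop :=
  (∀ i, 0 ≤ a i) ∧ ∑ i, a i = 1

/-- A sharp distribution: a single entry equal to 1, all others 0. -/
def IsSharp {α : Type*} [Fintype α] (a : α → ℝ) : Prop :=
  ∃ i, a i = 1 ∧ ∀ j, j ≠ i → a j = 0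

/-- The uniform distribution: all entries equal to `1 / |α|`. -/
def IsUniform {α : Type*} [Fintype α] (a : α → ℝ) : Prop :=
  ∀ i, a i = 1 / (Fintype.card α : ℝ)

/-- Tensor (Kronecker) product of two vectors. -/
def tensor {α β : Type*} (a : α → ℝ) (b : β → ℝ) : α × β → ℝ :=
  fun x => a x.1 * b x.2

/-- `n`-fold tensor power of a vector. -/
def tpow {α : Type*} (a : α → ℝ) (n : ℕ) : (Fin n → α) → ℝ :=
  fun f => ∏ j, a (f j)

/-- Shannon entropy (natural logarithm, with the convention `0 · ln 0 = 0`). -/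
def shannonH {α : Type*} [Fintype α] (a : α → ℝ) : ℝ :=
  -∑ i, a i * Real.log (a i)

/-- Entropy variance `V(a) = ∑ i, a i (ln a i + H(a))²`. -/
def entV {α : Type*} [Fintype α] (a : α → ℝ) : ℝ :=
  ∑ i, a i * (Real.log (a i) + shannonH a) ^ 2

/-- Relative entropy `D(a‖b)`. -/
def relD {α : Type*} [Fintype α] (a b : α → ℝ) : ℝ :=
  ∑ i, a i * Real.log (a i / b i)

/-- Relative entropy variance `V(a‖b)`. -/
def relV {α : Type*} [Fintype α] (a b : α → ℝ) : ℝ :=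
  ∑ i, a i * (Real.log (a i / b i) - relD a b) ^ 2

/-- Total variation distance. -/
def tvd {α : Type*} [Fintype α] (a b : α → ℝ) : ℝ :=
  (1 / 2) * ∑ i, |a i - b i|

/-- Fidelity `F(a,b) = (∑ i √(a i · b i))²`. -/
def fid {α : Type*} [Fintype α] (a b : α → ℝ) : ℝ :=
  (∑ i, Real.sqrt (a i * b i)) ^ 2

/-- The entries of `a` sorted in non-increasing order, as a vector on `Fin (card α)`. -/
def descSorted {α : Type*} [Fintype α] (a : α → ℝ) : Fin (Fintype.card α) → ℝ :=
  fun i =>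
    a ((Fintype.equivFin α).symm
      (Tuple.sort (fun j => -a ((Fintype.equivFin α).symm j)) i))

/-- `headSum a K = ∑_{1 ≤ i ≤ K} a^↓_i` (1-based indices `i`, comparison `(i : ℝ) ≤ K`,
equivalently `i ≤ ⌊K⌋`). -/
def headSum {α : Type*} [Fintype α] (a : α → ℝ) (K : ℝ) : ℝ :=
  ∑ i ∈ Finset.univ.filter (fun i : Fin (Fintype.card α) => ((i : ℕ) + 1 : ℝ) ≤ K),
    descSorted a i

/-- `tailSum a K = ∑_{i ≥ K} a^↓_i` (1-based indices `i`, comparison `K ≤ (i : ℝ)`,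
equivalently `i ≥ ⌈K⌉`). -/
def tailSum {α : Type*} [Fintype α] (a : α → ℝ) (K : ℝ) : ℝ :=
  ∑ i ∈ Finset.univ.filter (fun i : Fin (Fintype.card α) => K ≤ ((i : ℕ) + 1 : ℝ)),
    descSorted a i

/-- `a` majorises `b` (written `a ≻ b`): every partial sum of the non-increasingly sorted
`a` dominates the corresponding partial sum of sorted `b` (shorter vectors padded with zeros). -/
def Maj {α β : Type*} [Fintype α] [Fintype β] (a : α → ℝ) (b : β → ℝ) : Prop :=
  ∀ j : ℕ, headSum b (j : ℝ) ≤ headSum a (j : ℝ)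

/-- `a ≻_ε b`: approximate majorisation (from above) with total variation error:
there is a probability distribution `b̃` with `a ≻ b̃` and `δ(b, b̃) ≤ ε`. -/
def ApproxMajTV {α β : Type*} [Fintype α] [Fintype β] (a : α → ℝ) (b : β → ℝ) (ε : ℝ) : Prop :=
  ∃ bt : β → ℝ, IsProbDist bt ∧ Maj a bt ∧ tvd b bt ≤ ε

/-- `a ≺_ε b`: approximate majorisation (from below) with total variation error:
there is a probability distribution `b̃` with `a ≺ b̃` and `δ(b, b̃) ≤ ε`. -/
def ApproxSubMajTV {α β : Type*} [Fintype α] [Fintype β] (a : α → ℝ) (b : β → ℝ) (ε : ℝ) : Prop :=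
  ∃ bt : β → ℝ, IsProbDist bt ∧ Maj bt a ∧ tvd b bt ≤ ε

/-- A moderate sequence: `t n → 0` and `√n · t n → +∞`. -/
def ModerateSeq (t : ℕ → ℝ) : Prop :=
  Tendsto t atTop (𝓝 0) ∧ Tendsto (fun n : ℕ => Real.sqrt (n : ℝ) * t n) atTop atTop

/-- The uniform distribution on `Fin d`. -/
def unif (d : ℕ) : Fin d → ℝ := fun _ => 1 / (d : ℝ)

/-- The embedding map `Γ` associated with `γ_i = c_i / N`: for each `i` it produces
`c_i` entries equal to `a_i / c_i`. -/
def embed {d : ℕ} (c : Fin d → ℕ) (a : Fin d → ℝ) : (Σ i : Fin d, Fin (c i)) → ℝ :=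
  fun x => a x.1 / (c x.1 : ℝ)

/-- Cut-and-pile modification of the sorted version of `a`, with cut at `K`:
the first entry absorbs the total mass of entries at (1-based) positions `≥ K`,
entries at positions `1 < i < K` are unchanged, and entries at positions `≥ K` are set to 0. -/
def cutAndPile {α : Type*} [Fintype α] (a : α → ℝ) (K : ℝ) : Fin (Fintype.card α) → ℝ :=
  fun i =>
    if (i : ℕ) = 0 then descSorted a i + tailSum a K
    else if ((i : ℕ) + 1 : ℝ) < K then descSorted a i else 0

section Sorting

variable {α : Type*} [Fintype α]

theorem descSorted_antitone (a : α → ℝ) : Antitone (descSorted a) := by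
  intro i j hij
  have := Tuple.monotone_sort (fun j => -a ((Fintype.equivFin α).symm j)) hij
  simp only [Function.comp_apply, neg_le_neg_iff] at this
  exact this

theorem sum_comp_descSorted (a : α → ℝ) (g : ℝ → ℝ) :
    ∑ i, g (descSorted a i) = ∑ x, g (a x) :=
  Equiv.sum_comp ((Tuple.sort (fun j => -a ((Fintype.equivFin α).symm j))).trans
    (Fintype.equivFin α).symm) (fun x => g (a x))

theorem IsProbDist.descSorted_nonneg {a : α → ℝ} (ha : IsProbDist a) (i) :
    0 ≤ descSorted a i := ha.1 _

theorem IsProbDist.sum_descSorted {a : α → ℝ} (ha : IsProbDist a) :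
    ∑ i, descSorted a i = 1 :=
  (sum_comp_descSorted a id).trans ha.2

theorem IsProbDist.succ_mul_descSorted_le {a : α → ℝ} (ha : IsProbDist a)
    (i : Fin (Fintype.card α)) : ((i : ℕ) + 1 : ℝ) * descSorted a i ≤ 1 := by
  calc ((i : ℕ) + 1 : ℝ) * descSorted a i = ∑ _j ∈ Finset.Iic i, descSorted a i := by
        simp [Fin.card_Iic]
    _ ≤ ∑ j ∈ Finset.Iic i, descSorted a j :=
        Finset.sum_le_sum fun j hj => descSorted_antitone a (Finset.mem_Iic.1 hj)
    _ ≤ ∑ j, descSorted a j :=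
        Finset.sum_le_sum_of_subset_of_nonneg (Finset.subset_univ _)
          fun j _ _ => ha.descSorted_nonneg j
    _ = 1 := ha.sum_descSorted

theorem card_filter_succ_le (d : ℕ) {K : ℝ} (hK : 0 ≤ K) :
    (#(Finset.univ.filter fun i : Fin d => ((i : ℕ) + 1 : ℝ) ≤ K) : ℝ) ≤ K := by
  have h : #(Finset.univ.filter fun i : Fin d => ((i : ℕ) + 1 : ℝ) ≤ K) ≤ #(range ⌊K⌋₊) := by
    refine Finset.card_le_card_of_injOn (fun i => (i : ℕ)) ?_ (Fin.val_injective.injOn)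
    intro i hi
    have hi' : ((i : ℕ) + 1 : ℝ) ≤ K := by simpa using hi
    have : (i : ℕ) + 1 ≤ ⌊K⌋₊ := Nat.le_floor (by exact_mod_cast hi')
    simpa using this
  rw [Finset.card_range] at h
  exact (Nat.cast_le.2 h).trans (Nat.floor_le hK)

theorem IsProbDist.headSum_le_one {a : α → ℝ} (ha : IsProbDist a) (K : ℝ) : headSum a K ≤ 1 :=
  (Finset.sum_le_sum_of_subset_of_nonneg (Finset.subset_univ _)
    fun j _ _ => ha.descSorted_nonneg j).trans_eq ha.sum_descSorted

theorem IsProbDist.tailSum_le_one {a : α → ℝ} (ha : IsProbDist a) (K : ℝ) : tailSum a K ≤ 1 :=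
  (Finset.sum_le_sum_of_subset_of_nonneg (Finset.subset_univ _)
    fun j _ _ => ha.descSorted_nonneg j).trans_eq ha.sum_descSorted

theorem IsProbDist.one_le_headSum_add_tailSum {a : α → ℝ} (ha : IsProbDist a) (K : ℝ) :
    1 ≤ headSum a K + tailSum a K := by
  rw [← ha.sum_descSorted, headSum, tailSum, Finset.sum_filter, Finset.sum_filter,
    ← Finset.sum_add_distrib]
  refine Finset.sum_le_sum fun i _ => ?_
  have := ha.descSorted_nonneg i
  rcases le_total ((i : ℕ) + 1 : ℝ) K with h | h
  · rw [if_pos h]; split_ifs <;> linarith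
  · rw [if_pos h]; split_ifs <;> linarith

theorem IsProbDist.headSum_le {a : α → ℝ} (ha : IsProbDist a) {K θ : ℝ} (hK : 0 ≤ K)
    (hθ : 0 ≤ θ) : headSum a K ≤ (∑ x, if θ < a x then a x else 0) + K * θ := by
  rw [← sum_comp_descSorted a fun y => if θ < y then y else 0]
  calc headSum a K
      ≤ ∑ i ∈ Finset.univ.filter (fun i : Fin (Fintype.card α) => ((i : ℕ) + 1 : ℝ) ≤ K),
          ((if θ < descSorted a i then descSorted a i else 0) + θ) := by
        refine Finset.sum_le_sum fun i _ => ?_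
        split_ifs <;> linarith
    _ ≤ _ := by
        rw [Finset.sum_add_distrib]
        refine add_le_add (Finset.sum_le_sum_of_subset_of_nonneg (Finset.subset_univ _) ?_) ?_
        · intro i _ _
          have := ha.descSorted_nonneg i
          split_ifs <;> linarith
        · rw [Finset.sum_const, nsmul_eq_mul]
          exact mul_le_mul_of_nonneg_right (card_filter_succ_le _ hK) hθ

theorem IsProbDist.le_headSum {a : α → ℝ} (ha : IsProbDist a) {K : ℝ} (hK : 0 < K) :
    (∑ x, if K⁻¹ ≤ a x then a x else 0) ≤ headSum a K := by
  rw [← sum_comp_descSorted a fun y => if K⁻¹ ≤ y then y else 0, headSum, Finset.sum_filter]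
  refine Finset.sum_le_sum fun i _ => ?_
  have h0 := ha.descSorted_nonneg i
  by_cases h : K⁻¹ ≤ descSorted a i
  · have h1 := ha.succ_mul_descSorted_le i
    have h2 : ((i : ℕ) + 1 : ℝ) * K⁻¹ ≤ 1 :=
      (mul_le_mul_of_nonneg_left h (by positivity)).trans h1
    have h3 : ((i : ℕ) + 1 : ℝ) ≤ K := by
      rwa [← div_eq_mul_inv, div_le_one hK] at h2
    rw [if_pos h, if_pos h3]
  · rw [if_neg h]; split_ifs <;> linarith

theorem IsProbDist.tailSum_le {a : α → ℝ} (ha : IsProbDist a) {K : ℝ} (hK : 0 < K) :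
    tailSum a K ≤ ∑ x, if a x ≤ K⁻¹ then a x else 0 := by
  rw [← sum_comp_descSorted a fun y => if y ≤ K⁻¹ then y else 0, tailSum, Finset.sum_filter]
  refine Finset.sum_le_sum fun i _ => ?_
  have h0 := ha.descSorted_nonneg i
  by_cases h : K ≤ ((i : ℕ) + 1 : ℝ)
  · have h1 := ha.succ_mul_descSorted_le i
    have h2 : descSorted a i ≤ K⁻¹ := by
      rw [← one_div, le_div_iff₀ hK]
      nlinarith
    rw [if_pos h, if_pos h2]
  · rw [if_neg h]; split_ifs <;> linarith

theorem IsProbDist.le_tailSum {a : α → ℝ} (ha : IsProbDist a) {K θ : ℝ} (hK : 0 ≤ K)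
    (hθ : 0 ≤ θ) : (∑ x, if a x ≤ θ then a x else 0) - K * θ ≤ tailSum a K := by
  have h1 := ha.headSum_le hK hθ
  have h2 := ha.one_le_headSum_add_tailSum K
  have h3 : (∑ x, if a x ≤ θ then a x else 0) + (∑ x, if θ < a x then a x else 0) = 1 := by
    rw [← ha.2, ← Finset.sum_add_distrib]
    refine Finset.sum_congr rfl fun x _ => ?_
    by_cases h : a x ≤ θ
    · rw [if_pos h, if_neg (not_lt.2 h), add_zero]
    · rw [if_neg h, if_pos (not_le.1 h), zero_add]
  linarith

end Sorting

section LargeDeviations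

theorem tendsto_log_div_of_exp_bounds {u h : ℕ → ℝ} {ℓ : ℝ} (hu : Tendsto u atTop atTop)
    (hlow : ∀ c < ℓ, ∀ᶠ n in atTop, exp (c * u n) ≤ h n)
    (hupp : ∀ c > ℓ, ∀ᶠ n in atTop, h n ≤ exp (c * u n)) :
    Tendsto (fun n => log (h n) / u n) atTop (𝓝 ℓ) := by
  rw [tendsto_order]
  constructor
  · intro c hc
    obtain ⟨c', h1, h2⟩ := exists_between hc
    filter_upwards [hlow c' h2, hu.eventually_gt_atTop 0] with n hn hn0
    rw [lt_div_iff₀ hn0]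
    have := (le_log_iff_exp_le ((exp_pos _).trans_le hn)).2 hn
    nlinarith
  · intro c hc
    obtain ⟨c', h1, h2⟩ := exists_between hc
    filter_upwards [hupp c' h1, hlow (ℓ - 1) (by linarith), hu.eventually_gt_atTop 0]
      with n hn hn' hn0
    rw [div_lt_iff₀ hn0]
    have := (log_le_iff_le_exp ((exp_pos _).trans_le hn')).2 hn
    nlinarith

variable {Ω : ℕ → Type*} [∀ n, Fintype (Ω n)] {w X : ∀ n, Ω n → ℝ} {u : ℕ → ℝ}

/-- A quadratic limiting log-moment generating function at speed `u`. -/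
def QuadraticLogMGF (w X : ∀ n, Ω n → ℝ) (u : ℕ → ℝ) : Prop :=
  ∀ θ : ℝ, Tendsto (fun n => log (∑ x, w n x * exp (θ * u n * X n x)) / u n) atTop (𝓝 (θ ^ 2 / 2))

theorem QuadraticLogMGF.neg (h : QuadraticLogMGF w X u) :
    QuadraticLogMGF w (fun n x => -X n x) u := by
  intro θ
  have := h (-θ)
  simpa [neg_sq] using this

theorem QuadraticLogMGF.eventually_le (h : QuadraticLogMGF w X u) (hu : Tendsto u atTop atTop)
    (hw : ∀ n x, 0 ≤ w n x) {θ c : ℝ} (hc : θ ^ 2 / 2 < c) :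
    ∀ᶠ n in atTop, (∑ x, w n x * exp (θ * u n * X n x)) ≤ exp (c * u n) := by
  filter_upwards [(h θ).eventually_lt_const hc, hu.eventually_gt_atTop 0] with n hn hn0
  have h0 : 0 ≤ ∑ x, w n x * exp (θ * u n * X n x) :=
    Finset.sum_nonneg fun x _ => mul_nonneg (hw n x) (exp_pos _).le
  rcases h0.eq_or_lt with h0 | h0
  · rw [← h0]; exact (exp_pos _).le
  · rw [div_lt_iff₀ hn0] at hn
    exact (log_le_iff_le_exp h0).1 hn.le

theorem QuadraticLogMGF.eventually_ge (h : QuadraticLogMGF w X u) (hu : Tendsto u atTop atTop)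
    (hw : ∀ n, IsProbDist (w n)) {θ c : ℝ} (hc : c < θ ^ 2 / 2) :
    ∀ᶠ n in atTop, exp (c * u n) ≤ ∑ x, w n x * exp (θ * u n * X n x) := by
  filter_upwards [(h θ).eventually_const_lt hc, hu.eventually_gt_atTop 0] with n hn hn0
  have h0 : 0 < ∑ x, w n x * exp (θ * u n * X n x) := by
    obtain ⟨x, -, hx⟩ : ∃ x ∈ Finset.univ, 0 < w n x := by
      refine Finset.exists_lt_of_sum_lt (f := fun _ => (0 : ℝ)) ?_
      simp [(hw n).2]
    exact Finset.sum_pos' (fun x _ => mul_nonneg ((hw n).1 x) (exp_pos _).le)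
      ⟨x, Finset.mem_univ x, mul_pos hx (exp_pos _)⟩
  rw [lt_div_iff₀ hn0] at hn
  exact (le_log_iff_exp_le h0).1 hn.le

theorem QuadraticLogMGF.tail_le (h : QuadraticLogMGF w X u) (hu : Tendsto u atTop atTop)
    (hw : ∀ n x, 0 ≤ w n x) {y c : ℝ} (hy : 0 ≤ y) (hc : -(y ^ 2 / 2) < c) :
    ∀ᶠ n in atTop, (∑ x, if y ≤ X n x then w n x else 0) ≤ exp (c * u n) := by
  filter_upwards [h.eventually_le hu hw (θ := y) (c := c + y ^ 2) (by linarith),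
    hu.eventually_gt_atTop 0] with n hn hn0
  have h1 : (∑ x, if y ≤ X n x then w n x else 0) ≤
      exp (-(y ^ 2 * u n)) * ∑ x, w n x * exp (y * u n * X n x) := by
    rw [Finset.mul_sum]
    refine Finset.sum_le_sum fun x _ => ?_
    have hwx := hw n x
    split_ifs with hx
    · have : 1 ≤ exp (-(y ^ 2 * u n)) * exp (y * u n * X n x) := by
        rw [← exp_add]
        refine one_le_exp ?_
        have := mul_le_mul_of_nonneg_left hx (mul_nonneg hy hn0.le)
        nlinarith
      nlinarith
    · positivity
  refine h1.trans ((mul_le_mul_of_nonneg_left hn (exp_pos _).le).trans_eq ?_)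
  rw [← exp_add]; ring_nf

theorem QuadraticLogMGF.le_tail (h : QuadraticLogMGF w X u) (hu : Tendsto u atTop atTop)
    (hw : ∀ n, IsProbDist (w n)) {y c : ℝ} (hy : 0 ≤ y) (hc : c < -(y ^ 2 / 2)) :
    ∀ᶠ n in atTop, exp (c * u n) ≤ ∑ x, if y ≤ X n x then w n x else 0 := by
  obtain ⟨δ, hδ, hδc⟩ : ∃ δ > 0,
      c < (y + δ) ^ 2 / 2 - δ ^ 2 / 4 - (y + δ) * (y + 2 * δ) := by
    have ht : Tendsto (fun δ : ℝ => (y + δ) ^ 2 / 2 - δ ^ 2 / 4 - (y + δ) * (y + 2 * δ))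
        (𝓝[>] 0) (𝓝 ((y + 0) ^ 2 / 2 - 0 ^ 2 / 4 - (y + 0) * (y + 2 * 0))) :=
      (Continuous.tendsto (by fun_prop) 0).mono_left nhdsWithin_le_nhds
    have := (ht.eventually_const_lt (u := c) (by nlinarith)).and self_mem_nhdsWithin
    obtain ⟨δ, h1, h2⟩ := this.exists
    exact ⟨δ, h2, h1⟩
  have hw0 : ∀ n x, 0 ≤ w n x := fun n => (hw n).1
  have hδ2 : 0 < δ ^ 2 := by positivity
  have hr : Tendsto (fun n => exp (-(δ ^ 2 / 8 * u n))) atTop (𝓝 0) :=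
    tendsto_exp_neg_atTop_nhds_zero.comp (hu.const_mul_atTop (by positivity))
  filter_upwards [h.eventually_ge hu hw (θ := y + δ) (c := (y + δ) ^ 2 / 2 - δ ^ 2 / 8)
      (by linarith),
    h.eventually_le hu hw0 (θ := y + 2 * δ) (c := (y + 2 * δ) ^ 2 / 2 + δ ^ 2 / 8) (by linarith),
    h.eventually_le hu hw0 (θ := y) (c := y ^ 2 / 2 + δ ^ 2 / 8) (by linarith),
    hu.eventually_gt_atTop 0, hr.eventually_le_const (u := 1 / 2) (by norm_num)]
    with n h1 h2 h3 hn0 hr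
  have key : (∑ x, w n x * exp ((y + δ) * u n * X n x)) ≤
      exp ((y + δ) * (y + 2 * δ) * u n) * (∑ x, if y ≤ X n x then w n x else 0)
      + exp (-(δ * (y + 2 * δ) * u n)) * (∑ x, w n x * exp ((y + 2 * δ) * u n * X n x))
      + exp (δ * y * u n) * (∑ x, w n x * exp (y * u n * X n x)) := by
    rw [Finset.mul_sum, Finset.mul_sum, Finset.mul_sum, ← Finset.sum_add_distrib,
      ← Finset.sum_add_distrib]
    refine Finset.sum_le_sum fun x _ => ?_
    have hwx := hw0 n x
    rcases lt_or_ge (X n x) y with hx | hx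
    · have : exp ((y + δ) * u n * X n x) ≤ exp (δ * y * u n) * exp (y * u n * X n x) := by
        rw [← exp_add, exp_le_exp]
        nlinarith [mul_pos (mul_pos hδ hn0) (sub_pos.2 hx)]
      have h4 := mul_le_mul_of_nonneg_left this hwx
      rw [if_neg (not_le.2 hx)]
      have : 0 ≤ exp (-(δ * (y + 2 * δ) * u n)) * (w n x * exp ((y + 2 * δ) * u n * X n x)) := by
        positivity
      linarith
    · rw [if_pos hx]
      rcases le_or_gt (X n x) (y + 2 * δ) with hx' | hx'
      · have : exp ((y + δ) * u n * X n x) ≤ exp ((y + δ) * (y + 2 * δ) * u n) := by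
          rw [exp_le_exp]
          have : 0 ≤ (y + δ) * u n := by positivity
          nlinarith [mul_le_mul_of_nonneg_left hx' this]
        have h4 := mul_le_mul_of_nonneg_left this hwx
        have : 0 ≤ exp (-(δ * (y + 2 * δ) * u n)) *
          (w n x * exp ((y + 2 * δ) * u n * X n x)) := by positivity
        have : 0 ≤ exp (δ * y * u n) * (w n x * exp (y * u n * X n x)) := by positivity
        linarith
      · have : exp ((y + δ) * u n * X n x) ≤
            exp (-(δ * (y + 2 * δ) * u n)) * exp ((y + 2 * δ) * u n * X n x) := by
          rw [← exp_add, exp_le_exp]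
          nlinarith [mul_pos (mul_pos hδ hn0) (sub_pos.2 hx')]
        have h4 := mul_le_mul_of_nonneg_left this hwx
        have : 0 ≤ exp ((y + δ) * (y + 2 * δ) * u n) * w n x := by positivity
        have : 0 ≤ exp (δ * y * u n) * (w n x * exp (y * u n * X n x)) := by positivity
        linarith
  set A := exp ((y + δ) ^ 2 / 2 * u n) with hA
  set r := exp (-(δ ^ 2 / 8 * u n)) with hrdef
  have hA0 : 0 < A := exp_pos _
  have hr0 : 0 < r := exp_pos _
  have e1 : exp (((y + δ) ^ 2 / 2 - δ ^ 2 / 8) * u n) = A * r := by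
    rw [hA, hrdef, ← exp_add]; ring_nf
  have e2 : exp (-(δ * (y + 2 * δ) * u n)) * exp (((y + 2 * δ) ^ 2 / 2 + δ ^ 2 / 8) * u n)
      = A * r ^ 3 := by
    rw [hA, hrdef, ← exp_nat_mul, ← exp_add, ← exp_add]; push_cast; ring_nf
  have e3 : exp (δ * y * u n) * exp ((y ^ 2 / 2 + δ ^ 2 / 8) * u n) = A * r ^ 3 := by
    rw [hA, hrdef, ← exp_nat_mul, ← exp_add, ← exp_add]; push_cast; ring_nf
  have e4 : exp ((y + δ) * (y + 2 * δ) * u n) *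
      exp (((y + δ) ^ 2 / 2 - δ ^ 2 / 4 - (y + δ) * (y + 2 * δ)) * u n) = A * r ^ 2 := by
    rw [hA, hrdef, ← exp_nat_mul, ← exp_add, ← exp_add]; push_cast; ring_nf
  have h2' := mul_le_mul_of_nonneg_left h2 (exp_pos (-(δ * (y + 2 * δ) * u n))).le
  have h3' := mul_le_mul_of_nonneg_left h3 (exp_pos (δ * y * u n)).le
  rw [e2] at h2'
  rw [e3] at h3'
  rw [e1] at h1
  have hrr : r ^ 2 ≤ r - 2 * r ^ 3 := by
    nlinarith [mul_nonneg hr0.le (mul_nonneg (sub_nonneg.2 hr) hr0.le),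
      mul_nonneg hr0.le (sub_nonneg.2 hr)]
  have h5 := mul_le_mul_of_nonneg_left hrr hA0.le
  have h6 : A * r ^ 2 ≤ exp ((y + δ) * (y + 2 * δ) * u n) *
      (∑ x, if y ≤ X n x then w n x else 0) := by linarith
  rw [← e4] at h6
  refine le_trans ?_ (le_of_mul_le_mul_left h6 (exp_pos _))
  rw [exp_le_exp]
  exact mul_le_mul_of_nonneg_right hδc.le hn0.le

end LargeDeviations

section MomentGenerating

theorem tendsto_exp_mul_sub_div_sq (z : ℝ) :
    Tendsto (fun l : ℝ => (exp (l * z) - 1 - l * z) / l ^ 2) (𝓝[≠] 0) (𝓝 (z ^ 2 / 2)) := by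
  have h := (Real.exp_sub_sum_range_succ_isLittleO_pow 2).comp_tendsto
    (show Tendsto (fun l : ℝ => l * z) (𝓝[≠] 0) (𝓝 0) from
      (Continuous.tendsto' (by fun_prop) 0 0 (by simp)).mono_left nhdsWithin_le_nhds)
  have h2 : (fun l : ℝ => exp (l * z) - 1 - l * z - (l * z) ^ 2 / 2) =o[𝓝[≠] 0]
      fun l : ℝ => l ^ 2 := by
    refine (h.congr_left fun l => ?_).trans_isBigO (Asymptotics.IsBigO.of_bound (z ^ 2) ?_)
    · simp [Finset.sum_range_succ]; ring
    · refine Eventually.of_forall fun l => ?_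
      simp [mul_pow, mul_comm]
  have h3 := h2.tendsto_div_nhds_zero.add_const (z ^ 2 / 2)
  rw [zero_add] at h3
  refine h3.congr' ?_
  filter_upwards [self_mem_nhdsWithin] with l hl
  have : l ≠ 0 := hl
  field_simp
  ring

theorem tendsto_log_mgf_div_sq {ι : Type*} [Fintype ι] {p Z : ι → ℝ} {V : ℝ} (hp : IsProbDist p)
    (hmean : ∑ i, p i * Z i = 0) (hvar : ∑ i, p i * Z i ^ 2 = V) (hV : 0 < V) :
    Tendsto (fun l : ℝ => log (∑ i, p i * exp (l * Z i)) / l ^ 2) (𝓝[≠] 0) (𝓝 (V / 2)) := by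
  have h1 : Tendsto (fun l : ℝ => ((∑ i, p i * exp (l * Z i)) - 1) / l ^ 2) (𝓝[≠] 0)
      (𝓝 (V / 2)) := by
    have := tendsto_finsetSum Finset.univ fun i _ =>
      (tendsto_exp_mul_sub_div_sq (Z i)).const_mul (p i)
    have hs : ∑ i, p i * (Z i ^ 2 / 2) = V / 2 := by
      rw [← hvar, Finset.sum_div]; exact Finset.sum_congr rfl fun i _ => by ring
    rw [hs] at this
    refine this.congr fun l => ?_
    have e : ∑ i, p i * (exp (l * Z i) - 1 - l * Z i) = (∑ i, p i * exp (l * Z i)) - 1 := by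
      have : ∀ i, p i * (exp (l * Z i) - 1 - l * Z i) =
        p i * exp (l * Z i) - p i - l * (p i * Z i) := fun i => by ring
      simp only [this, Finset.sum_sub_distrib, ← Finset.mul_sum, hmean, hp.2]
      ring
    rw [← e, Finset.sum_div]
    exact Finset.sum_congr rfl fun i _ => by ring
  have h2 : Tendsto (fun l : ℝ => ∑ i, p i * exp (l * Z i)) (𝓝[≠] 0) (𝓝[≠] 1) := by
    refine tendsto_nhdsWithin_iff.2 ⟨?_, ?_⟩
    · refine (Continuous.tendsto' (by fun_prop) 0 1 ?_).mono_left nhdsWithin_le_nhds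
      simp [hp.2]
    · filter_upwards [h1.eventually_const_lt (half_pos hV)] with l hl h
      rw [Set.mem_singleton_iff.1 h, sub_self, zero_div] at hl
      exact lt_irrefl _ hl
  have h3 := (hasDerivAt_iff_tendsto_slope.1 (Real.hasDerivAt_log one_ne_zero)).comp h2
  have h4 := h3.mul h1
  rw [inv_one, one_mul] at h4
  refine h4.congr' ?_
  filter_upwards [h2 self_mem_nhdsWithin] with l hl
  have : (∑ i, p i * exp (l * Z i)) - 1 ≠ 0 := sub_ne_zero.2 hl
  simp only [Function.comp_apply, slope_def_field, log_one, sub_zero]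
  field_simp

end MomentGenerating

section TotalDistribution

theorem sum_tpow_mul_prod {α : Type*} [Fintype α] (a g : α → ℝ) (n : ℕ) :
    ∑ x, tpow a n x * ∏ j, g (x j) = (∑ i, a i * g i) ^ n := by
  classical
  simp only [tpow, ← Finset.prod_mul_distrib]
  simpa using (Finset.sum_pow' Finset.univ (fun i => a i * g i) n).symm

theorem IsProbDist.tpow {α : Type*} [Fintype α] {a : α → ℝ} (ha : IsProbDist a) (n : ℕ) :
    IsProbDist (tpow a n) :=
  ⟨fun _ => Finset.prod_nonneg fun _ _ => ha.1 _, by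
    simpa [ha.2] using sum_tpow_mul_prod a (fun _ => 1) n⟩

theorem IsProbDist.tensor {α β : Type*} [Fintype α] [Fintype β] {a : α → ℝ} {b : β → ℝ}
    (ha : IsProbDist a) (hb : IsProbDist b) : IsProbDist (tensor a b) :=
  ⟨fun _ => mul_nonneg (ha.1 _) (hb.1 _), by
    simp only [_root_.tensor, Fintype.sum_prod_type, ← Finset.mul_sum, hb.2, mul_one, ha.2]⟩

theorem IsProbDist.log_eq_neg_shannonH {α : Type*} [Fintype α] {f : α → ℝ} (hf : IsProbDist f)
    (h : IsSharp f ∨ IsUniform f) (i : α) (hi : f i ≠ 0) : log (f i) = -shannonH f := by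
  rcases h with ⟨k, hk, hk0⟩ | h
  · have hik : i = k := by
      by_contra hne
      exact hi (hk0 i hne)
    have : ∀ j, f j * log (f j) = 0 := fun j => by
      by_cases hj : j = k
      · rw [hj, hk, log_one, mul_zero]
      · rw [hk0 j hj, zero_mul]
    simp [shannonH, this, hik, hk]
  · have : ∀ j, f j = f i := fun j => by rw [h, h]
    have e : ∑ j, f j * log (f j) = ∑ j, f j * log (f i) :=
      Finset.sum_congr rfl fun j _ => by rw [this j]
    rw [shannonH, neg_neg, e, ← Finset.sum_mul, hf.2, one_mul]

end TotalDistribution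

section SortedTails

variable {Ω : ℕ → Type*} [∀ n, Fintype (Ω n)] {w X : ∀ n, Ω n → ℝ} {u b s y : ℕ → ℝ} {y₀ : ℝ}

theorem eventually_exp_neg_mul_le (hs : ∀ᶠ n in atTop, 0 < s n)
    (hus : Tendsto (fun n => u n / s n) atTop (𝓝 0)) {δ : ℝ} (hδ : 0 < δ) (c : ℝ) :
    ∀ᶠ n in atTop, exp (-(δ * s n)) ≤ exp (c * u n) := by
  have h := hus.const_mul c
  rw [mul_zero] at h
  filter_upwards [hs, h.eventually_const_lt (u := -δ) (by linarith)] with n hn hn'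
  rw [exp_le_exp]
  rw [← mul_div_assoc, lt_div_iff₀ hn] at hn'
  linarith

theorem eventually_two_mul_exp_le (hu : Tendsto u atTop atTop) {c c' : ℝ} (hc : c < c') :
    ∀ᶠ n in atTop, 2 * exp (c * u n) ≤ exp (c' * u n) := by
  have h := tendsto_exp_atTop.comp (hu.const_mul_atTop (sub_pos.2 hc))
  filter_upwards [h.eventually_ge_atTop 2] with n hn
  have e : exp (c' * u n) = exp ((c' - c) * u n) * exp (c * u n) := by
    rw [← exp_add]; ring_nf
  rw [e]
  exact mul_le_mul_of_nonneg_right hn (exp_pos _).le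

theorem exp_neg_le_iff {a b s X y : ℝ} (ha : 0 < a) (hlog : log a = -(b + s * X)) (hs : 0 < s) :
    exp (-(b + y * s)) ≤ a ↔ X ≤ y := by
  rw [← le_log_iff_exp_le ha, hlog, neg_le_neg_iff, add_le_add_iff_left, mul_comm y,
    mul_le_mul_iff_right₀ hs]

theorem le_exp_neg_iff {a b s X y : ℝ} (ha : 0 < a) (hlog : log a = -(b + s * X)) (hs : 0 < s) :
    a ≤ exp (-(b + y * s)) ↔ y ≤ X := by
  rw [← log_le_iff_le_exp ha, hlog, neg_le_neg_iff, add_le_add_iff_left, mul_comm y,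
    mul_le_mul_iff_right₀ hs]

/-- Logarithmic asymptotics of the head of sorted distributions whose surprisal is
`b + s * X` with `X` of quadratic log-moment generating function. -/
theorem tendsto_log_headSum (hw : ∀ n, IsProbDist (w n)) (hX : QuadraticLogMGF w X u)
    (hu : Tendsto u atTop atTop) (hs : ∀ᶠ n in atTop, 0 < s n)
    (hus : Tendsto (fun n => u n / s n) atTop (𝓝 0))
    (hlog : ∀ᶠ n in atTop, ∀ x, w n x ≠ 0 → log (w n x) = -(b n + s n * X n x))
    (hy : Tendsto y atTop (𝓝 y₀)) (hy₀ : y₀ ≤ 0) :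
    Tendsto (fun n => log (headSum (w n) (exp (b n + y n * s n))) / u n) atTop
      (𝓝 (-(y₀ ^ 2 / 2))) := by
  have hw0 : ∀ n x, 0 ≤ w n x := fun n => (hw n).1
  refine tendsto_log_div_of_exp_bounds hu (fun c hc => ?_) fun c hc => ?_
  · obtain ⟨z, hz, hzc⟩ : ∃ z < y₀, c < -(z ^ 2 / 2) := by
      have ht : Tendsto (fun z : ℝ => -(z ^ 2 / 2)) (𝓝[<] y₀) (𝓝 (-(y₀ ^ 2 / 2))) :=
        (Continuous.tendsto (by fun_prop) y₀).mono_left nhdsWithin_le_nhds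
      obtain ⟨z, h1, h2⟩ := ((ht.eventually_const_lt hc).and self_mem_nhdsWithin).exists
      exact ⟨z, h2, h1⟩
    filter_upwards [hX.neg.le_tail hu hw (y := -z) (c := c) (by linarith) (by simpa using hzc),
      hs, hlog, hy.eventually_const_lt hz] with n h1 hs hlog hy
    refine h1.trans (le_trans ?_ ((hw n).le_headSum (exp_pos _)))
    refine Finset.sum_le_sum fun x _ => ?_
    rcases (hw0 n x).eq_or_lt with h0 | h0
    · simp [← h0]
    · rw [← exp_neg]
      simp only [exp_neg_le_iff h0 (hlog x h0.ne') hs, neg_le_neg_iff]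
      split_ifs <;> linarith
  · rcases hy₀.eq_or_lt with rfl | hy₀
    · filter_upwards [hu.eventually_gt_atTop 0] with n hn
      refine ((hw n).headSum_le_one _).trans (one_le_exp ?_)
      have : 0 < c := by simpa using hc
      positivity
    · obtain ⟨z, ⟨hz, hz0⟩, hzc⟩ : ∃ z, (y₀ < z ∧ z < 0) ∧ -(z ^ 2 / 2) < c := by
        have ht : Tendsto (fun z : ℝ => -(z ^ 2 / 2)) (𝓝[>] y₀) (𝓝 (-(y₀ ^ 2 / 2))) :=
          (Continuous.tendsto (by fun_prop) y₀).mono_left nhdsWithin_le_nhds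
        obtain ⟨z, h1, h2⟩ := ((ht.eventually_lt_const hc).and (Ioo_mem_nhdsGT hy₀)).exists
        exact ⟨z, h2, h1⟩
      obtain ⟨c', h1, h2⟩ := exists_between hzc
      obtain ⟨y', hy1, hy2⟩ := exists_between hz
      filter_upwards [hX.neg.tail_le hu hw0 (y := -z) (c := c') (by linarith) (by simpa using h1),
        eventually_exp_neg_mul_le hs hus (sub_pos.2 hy2) c', eventually_two_mul_exp_le hu h2,
        hs, hlog, hy.eventually_lt_const hy1] with n h1 h2 h3 hs hlog hy
      refine ((hw n).headSum_le (exp_pos _).le (exp_pos (-(b n + z * s n))).le).trans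
        (le_trans ?_ h3)
      rw [two_mul]
      refine add_le_add (le_trans (Finset.sum_le_sum fun x _ => ?_) h1) (le_trans ?_ h2)
      · rcases (hw0 n x).eq_or_lt with h0 | h0
        · simp [← h0]
        · simp only [neg_le_neg_iff, ← exp_neg_le_iff h0 (hlog x h0.ne') hs]
          split_ifs <;> linarith
      · rw [← exp_add, exp_le_exp]
        nlinarith

/-- Logarithmic asymptotics of the tail of sorted distributions whose surprisal is
`b + s * X` with `X` of quadratic log-moment generating function. -/
theorem tendsto_log_tailSum (hw : ∀ n, IsProbDist (w n)) (hX : QuadraticLogMGF w X u)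
    (hu : Tendsto u atTop atTop) (hs : ∀ᶠ n in atTop, 0 < s n)
    (hus : Tendsto (fun n => u n / s n) atTop (𝓝 0))
    (hlog : ∀ᶠ n in atTop, ∀ x, w n x ≠ 0 → log (w n x) = -(b n + s n * X n x))
    (hy : Tendsto y atTop (𝓝 y₀)) (hy₀ : 0 ≤ y₀) :
    Tendsto (fun n => log (tailSum (w n) (exp (b n + y n * s n))) / u n) atTop
      (𝓝 (-(y₀ ^ 2 / 2))) := by
  have hw0 : ∀ n x, 0 ≤ w n x := fun n => (hw n).1
  refine tendsto_log_div_of_exp_bounds hu (fun c hc => ?_) fun c hc => ?_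
  · obtain ⟨z, hz, hzc⟩ : ∃ z > y₀, c < -(z ^ 2 / 2) := by
      have ht : Tendsto (fun z : ℝ => -(z ^ 2 / 2)) (𝓝[>] y₀) (𝓝 (-(y₀ ^ 2 / 2))) :=
        (Continuous.tendsto (by fun_prop) y₀).mono_left nhdsWithin_le_nhds
      obtain ⟨z, h1, h2⟩ := ((ht.eventually_const_lt hc).and self_mem_nhdsWithin).exists
      exact ⟨z, h2, h1⟩
    obtain ⟨c', h1, h2⟩ := exists_between hzc
    obtain ⟨y', hy1, hy2⟩ := exists_between hz
    filter_upwards [hX.le_tail hu hw (y := z) (c := c') (by linarith) h2,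
      eventually_exp_neg_mul_le hs hus (sub_pos.2 hy2) c, eventually_two_mul_exp_le hu h1,
      hs, hlog, hy.eventually_lt_const hy1] with n h1 h2 h3 hs hlog hy
    refine le_trans ?_ ((hw n).le_tailSum (exp_pos _).le (exp_pos (-(b n + z * s n))).le)
    have h4 : (∑ x, if z ≤ X n x then w n x else 0) ≤
        ∑ x, if w n x ≤ exp (-(b n + z * s n)) then w n x else 0 := by
      refine Finset.sum_le_sum fun x _ => ?_
      rcases (hw0 n x).eq_or_lt with h0 | h0
      · simp [← h0]
      · simp only [le_exp_neg_iff h0 (hlog x h0.ne') hs, le_refl]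
    have h5 : exp (b n + y n * s n) * exp (-(b n + z * s n)) ≤ exp (-((z - y') * s n)) := by
      rw [← exp_add, exp_le_exp]
      nlinarith
    linarith
  · rcases hy₀.eq_or_lt with rfl | hy₀
    · filter_upwards [hu.eventually_gt_atTop 0] with n hn
      refine ((hw n).tailSum_le_one _).trans (one_le_exp ?_)
      have : 0 < c := by simpa using hc
      positivity
    · obtain ⟨z, ⟨hz0, hz⟩, hzc⟩ : ∃ z, (0 < z ∧ z < y₀) ∧ -(z ^ 2 / 2) < c := by
        have ht : Tendsto (fun z : ℝ => -(z ^ 2 / 2)) (𝓝[<] y₀) (𝓝 (-(y₀ ^ 2 / 2))) :=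
          (Continuous.tendsto (by fun_prop) y₀).mono_left nhdsWithin_le_nhds
        obtain ⟨z, h1, h2⟩ := ((ht.eventually_lt_const hc).and (Ioo_mem_nhdsLT hy₀)).exists
        exact ⟨z, h2, h1⟩
      filter_upwards [hX.tail_le hu hw0 (y := z) (c := c) hz0.le hzc,
        hs, hlog, hy.eventually_const_lt hz] with n h1 hs hlog hy
      refine ((hw n).tailSum_le (exp_pos _)).trans (le_trans ?_ h1)
      refine Finset.sum_le_sum fun x _ => ?_
      rcases (hw0 n x).eq_or_lt with h0 | h0
      · simp [← h0]
      · rw [← exp_neg]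
        simp only [le_exp_neg_iff h0 (hlog x h0.ne') hs]
        split_ifs <;> linarith

end SortedTails

section TensorPowers

variable {ι κ : Type*} [Fintype ι] [Fintype κ] {p : ι → ℝ} {f : κ → ℝ}

theorem log_tensor_tpow (hflat : ∀ i, f i ≠ 0 → log (f i) = -shannonH f) {N M : ℕ}
    (x : (Fin N → ι) × (Fin M → κ)) (hx : tensor (tpow p N) (tpow f M) x ≠ 0) :
    log (tensor (tpow p N) (tpow f M) x) =
      -(N * shannonH p + M * shannonH f + ∑ j, (-log (p (x.1 j)) - shannonH p)) := by
  obtain ⟨h1, h2⟩ := mul_ne_zero_iff.1 hx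
  have h1' := Finset.prod_ne_zero_iff.1 h1
  have h2' := Finset.prod_ne_zero_iff.1 h2
  have e : log (tpow f M x.2) = -(M * shannonH f) := by
    rw [tpow, log_prod h2', Finset.sum_congr rfl fun j hj => hflat _ (h2' j hj)]
    simp
  rw [tensor, log_mul h1 h2, e, tpow, log_prod h1']
  simp only [Finset.sum_sub_distrib, Finset.sum_neg_distrib, Finset.sum_const, Finset.card_univ,
    Fintype.card_fin, nsmul_eq_mul]
  ring

theorem sum_tensor_tpow_mul_exp (hf : IsProbDist f) (Z : ι → ℝ) (N M : ℕ) (l : ℝ) :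
    ∑ x, tensor (tpow p N) (tpow f M) x * exp (l * ∑ j, Z (x.1 j)) =
      (∑ i, p i * exp (l * Z i)) ^ N := by
  rw [← sum_tpow_mul_prod, Fintype.sum_prod_type]
  refine Finset.sum_congr rfl fun x _ => ?_
  simp only [tensor, Finset.mul_sum, exp_sum]
  rw [← Finset.sum_mul, ← Finset.mul_sum, (hf.tpow M).2, mul_one]

theorem IsProbDist.sum_mul_surprisal (hp : IsProbDist p) :
    ∑ i, p i * (-log (p i) - shannonH p) = 0 := by
  have : ∀ i, p i * (-log (p i) - shannonH p) = -(p i * log (p i)) - p i * shannonH p :=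
    fun i => by ring
  simp only [this, Finset.sum_sub_distrib, ← Finset.sum_mul, hp.2, Finset.sum_neg_distrib, one_mul]
  exact sub_self _

variable {N M : ℕ → ℕ} {s : ℕ → ℝ}

theorem quadraticLogMGF_tensor_tpow (hp : IsProbDist p) (hf : IsProbDist f) (hV : 0 < entV p)
    (hN : ∀ᶠ n in atTop, 0 < N n) (hs : ∀ᶠ n in atTop, 0 < s n)
    (hsN : Tendsto (fun n => s n / N n) atTop (𝓝 0)) :
    QuadraticLogMGF (fun n => tensor (tpow p (N n)) (tpow f (M n)))
      (fun n x => (∑ j, (-log (p (x.1 j)) - shannonH p)) / s n)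
      (fun n => s n ^ 2 / (N n * entV p)) := by
  intro θ
  rcases eq_or_ne θ 0 with rfl | hθ
  · simp [((hp.tpow _).tensor (hf.tpow _)).2]
  have hvar : ∑ i, p i * (-log (p i) - shannonH p) ^ 2 = entV p :=
    Finset.sum_congr rfl fun i _ => by ring
  have h := tendsto_log_mgf_div_sq hp hp.sum_mul_surprisal hvar hV
  have hl : Tendsto (fun n => θ / entV p * (s n / N n)) atTop (𝓝[≠] 0) := by
    refine tendsto_nhdsWithin_iff.2 ⟨by simpa using hsN.const_mul (θ / entV p), ?_⟩
    filter_upwards [hN, hs] with n hN hs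
    have : (0 : ℝ) < N n := Nat.cast_pos.2 hN
    exact mul_ne_zero (div_ne_zero hθ hV.ne') (div_pos hs this).ne'
  have h2 := (h.comp hl).const_mul (θ ^ 2 / entV p)
  have e : θ ^ 2 / entV p * (entV p / 2) = θ ^ 2 / 2 := by
    field_simp
  rw [e] at h2
  refine h2.congr' ?_
  filter_upwards [hN, hs] with n hN hs
  have hN' : (0 : ℝ) < N n := Nat.cast_pos.2 hN
  have e1 : ∀ S : ℝ, θ * (s n ^ 2 / (N n * entV p)) * (S / s n) =
      θ / entV p * (s n / N n) * S := fun S => by field_simp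
  simp only [e1, sum_tensor_tpow_mul_exp hf (fun i => -log (p i) - shannonH p), Function.comp_apply,
    log_pow]
  field_simp

theorem tendsto_log_headSum_tailSum_tensor_tpow (hp : IsProbDist p) (hf : IsProbDist f)
    (hflat : ∀ i, f i ≠ 0 → log (f i) = -shannonH f) (hV : 0 < entV p)
    (hN : ∀ᶠ n in atTop, 0 < N n) (hs : ∀ᶠ n in atTop, 0 < s n)
    (hsN : Tendsto (fun n => s n / N n) atTop (𝓝 0))
    (hu : Tendsto (fun n => s n ^ 2 / (N n * entV p)) atTop atTop)
    {y : ℕ → ℝ} {y₀ : ℝ} (hy : Tendsto y atTop (𝓝 y₀)) {v : ℕ → ℝ} {c : ℝ}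
    (hv : Tendsto (fun n => s n ^ 2 / (N n * entV p) / v n) atTop (𝓝 c)) {K : ℕ → ℝ}
    (hK : ∀ᶠ n in atTop, K n = exp (N n * shannonH p + M n * shannonH f + y n * s n)) :
    (y₀ ≤ 0 → Tendsto (fun n => log (headSum (tensor (tpow p (N n)) (tpow f (M n))) (K n)) / v n)
      atTop (𝓝 (-(y₀ ^ 2 / 2) * c))) ∧
    (0 ≤ y₀ → Tendsto (fun n => log (tailSum (tensor (tpow p (N n)) (tpow f (M n))) (K n)) / v n)
      atTop (𝓝 (-(y₀ ^ 2 / 2) * c))) := by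
  have hw : ∀ n, IsProbDist (tensor (tpow p (N n)) (tpow f (M n))) :=
    fun n => (hp.tpow _).tensor (hf.tpow _)
  have hX := quadraticLogMGF_tensor_tpow (M := M) hp hf hV hN hs hsN
  have hus : Tendsto (fun n => s n ^ 2 / (N n * entV p) / s n) atTop (𝓝 0) := by
    have := hsN.div_const (entV p)
    rw [zero_div] at this
    refine this.congr' ?_
    filter_upwards [hs] with n hs
    field_simp
  have hlog : ∀ᶠ n in atTop, ∀ x : (Fin (N n) → ι) × (Fin (M n) → κ),
      tensor (tpow p (N n)) (tpow f (M n)) x ≠ 0 →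
      log (tensor (tpow p (N n)) (tpow f (M n)) x) = -((N n * shannonH p + M n * shannonH f) +
        s n * ((∑ j, (-log (p (x.1 j)) - shannonH p)) / s n)) := by
    filter_upwards [hs] with n hs x hx
    rw [mul_div_cancel₀ _ hs.ne', log_tensor_tpow hflat x hx]
  constructor <;> intro hy₀
  · refine ((tendsto_log_headSum hw hX hu hs hus hlog hy hy₀).mul hv).congr' ?_
    filter_upwards [hK, hu.eventually_gt_atTop 0] with n hK hu
    rw [hK]
    exact div_mul_div_cancel₀ hu.ne'
  · refine ((tendsto_log_tailSum hw hX hu hs hus hlog hy hy₀).mul hv).congr' ?_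
    filter_upwards [hK, hu.eventually_gt_atTop 0] with n hK hu
    rw [hK]
    exact div_mul_div_cancel₀ hu.ne'

end TensorPowers

/-- Tail bounds for the total input and output distributions `P^n` and `Q^n`. -/
theorem tail_bounds_total_distributions
    {dp dq df : ℕ} (p : Fin dp → ℝ) (q : Fin dq → ℝ) (f : Fin df → ℝ)
    (hp : IsProbDist p) (hq : IsProbDist q) (hf : IsProbDist f)
    (hfsu : IsSharp f ∨ IsUniform f)
    (hVp : 0 < entV p) (hVq : 0 < entV q)
    (hfp : shannonH f ≠ shannonH p) (hfq : shannonH f ≠ shannonH q)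
    (hratio : 0 < (shannonH f - shannonH p) / (shannonH f - shannonH q))
    (t : ℕ → ℝ) (ht : ModerateSeq t) (μ : ℝ)
    (m : ℕ → ℕ)
    (hm : ∀ n : ℕ, m n =
      ⌊(n : ℝ) * ((shannonH f - shannonH p + μ * t n) / (shannonH f - shannonH q))⌋₊)
    (K : ℕ → ℝ → ℝ)
    (hK : ∀ n : ℕ, ∀ x : ℝ, K n x =
      Real.exp ((m n : ℝ) * shannonH q + (n : ℝ) * shannonH f + x * n * t n))
    (ν : ℝ)
    (hν : ν = (entV p / entV q) * ((shannonH f - shannonH q) / (shannonH f - shannonH p))) :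
    (∀ x ≤ (0 : ℝ), Tendsto (fun n : ℕ =>
        Real.log (headSum (tensor (tpow q (m n)) (tpow f n)) (K n x)) / ((n : ℝ) * t n ^ 2))
      atTop (𝓝 (-(ν * x ^ 2) / (2 * entV p)))) ∧
    (∀ x ≥ (0 : ℝ), Tendsto (fun n : ℕ =>
        Real.log (tailSum (tensor (tpow q (m n)) (tpow f n)) (K n x)) / ((n : ℝ) * t n ^ 2))
      atTop (𝓝 (-(ν * x ^ 2) / (2 * entV p)))) ∧
    (∀ x ≤ μ, Tendsto (fun n : ℕ =>
        Real.log (headSum (tensor (tpow p n) (tpow f (m n))) (K n x)) / ((n : ℝ) * t n ^ 2))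
      atTop (𝓝 (-(x - μ) ^ 2 / (2 * entV p)))) ∧
    (∀ x ≥ μ, Tendsto (fun n : ℕ =>
        Real.log (tailSum (tensor (tpow p n) (tpow f (m n))) (K n x)) / ((n : ℝ) * t n ^ 2))
      atTop (𝓝 (-(x - μ) ^ 2 / (2 * entV p)))) := by
  obtain ⟨ht0, htop⟩ := ht
  have hflat := hf.log_eq_neg_shannonH hfsu
  have hD : shannonH f - shannonH q ≠ 0 := sub_ne_zero.2 hfq
  have hE : shannonH f - shannonH p ≠ 0 := sub_ne_zero.2 hfp
  set D := shannonH f - shannonH q with hDdef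
  set E := shannonH f - shannonH p with hEdef
  have hn : ∀ᶠ n : ℕ in atTop, (0 : ℝ) < n := by
    filter_upwards [eventually_gt_atTop 0] with n hn using Nat.cast_pos.2 hn
  have hs : ∀ᶠ n : ℕ in atTop, 0 < (n : ℝ) * t n := by
    filter_upwards [hn, htop.eventually_gt_atTop 0] with n hn h
    exact mul_pos hn (pos_of_mul_pos_right h (sqrt_nonneg _))
  have hv : Tendsto (fun n : ℕ => (n : ℝ) * t n ^ 2) atTop atTop := by
    refine (htop.atTop_mul_atTop₀ htop).congr fun n => ?_
    have := Real.mul_self_sqrt (Nat.cast_nonneg (α := ℝ) n)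
    linear_combination t n ^ 2 * this
  have hst : Tendsto (fun n : ℕ => (n : ℝ) * t n) atTop atTop := by
    refine ((tendsto_sqrt_atTop.comp tendsto_natCast_atTop_atTop).atTop_mul_atTop₀ htop).congr
      fun n => ?_
    have := Real.mul_self_sqrt (Nat.cast_nonneg (α := ℝ) n)
    simp only [Function.comp_apply]
    linear_combination t n * this
  have hρ : Tendsto (fun n => (E + μ * t n) / D) atTop (𝓝 (E / D)) := by
    simpa using ((ht0.const_mul μ).const_add E).div_const D
  have hfloor : ∀ᶠ n : ℕ in atTop, 0 ≤ (n : ℝ) * ((E + μ * t n) / D) - m n ∧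
      (n : ℝ) * ((E + μ * t n) / D) - m n ≤ 1 := by
    filter_upwards [hρ.eventually_const_lt hratio] with n h
    rw [hm n]
    have h0 : 0 ≤ (n : ℝ) * ((E + μ * t n) / D) := mul_nonneg (Nat.cast_nonneg n) h.le
    have h1 := Nat.floor_le h0
    have h2 := Nat.lt_floor_add_one ((n : ℝ) * ((E + μ * t n) / D))
    constructor <;> linarith
  have hmn : Tendsto (fun n : ℕ => (m n : ℝ) / n) atTop (𝓝 (E / D)) := by
    have h1 : Tendsto (fun n : ℕ => (E + μ * t n) / D - 1 / (n : ℝ)) atTop (𝓝 (E / D)) := by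
      simpa using hρ.sub tendsto_one_div_atTop_nhds_zero_nat
    refine tendsto_of_tendsto_of_tendsto_of_le_of_le' h1 hρ ?_ ?_
    · filter_upwards [hn, hfloor] with n hn h
      rw [le_div_iff₀ hn, sub_mul, one_div_mul_cancel hn.ne']
      linarith
    · filter_upwards [hn, hfloor] with n hn h
      rw [div_le_iff₀ hn]
      linarith
  have hm0 : ∀ᶠ n in atTop, 0 < m n := by
    filter_upwards [hn, hmn.eventually_const_lt hratio] with n hn h
    exact Nat.cast_pos.1 ((div_pos_iff_of_pos_right hn).1 h)
  have hQ : ∀ x : ℝ, _ := fun x => by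
    have hv' : Tendsto (fun n : ℕ => ((n : ℝ) * t n) ^ 2 / (m n * entV q) / ((n : ℝ) * t n ^ 2))
        atTop (𝓝 ((E / D)⁻¹ / entV q)) := by
      refine ((hmn.inv₀ hratio.ne').div_const (entV q)).congr' ?_
      filter_upwards [hn, hs, hm0] with n hn hs hm0
      have : (m n : ℝ) ≠ 0 := Nat.cast_ne_zero.2 hm0.ne'
      have : t n ≠ 0 := (pos_of_mul_pos_right hs hn.le).ne'
      field_simp
    have hu : Tendsto (fun n : ℕ => ((n : ℝ) * t n) ^ 2 / (m n * entV q)) atTop atTop := by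
      refine (hv'.pos_mul_atTop (by positivity) hv).congr' ?_
      filter_upwards [hv.eventually_gt_atTop 0] with n h
      exact div_mul_cancel₀ _ h.ne'
    have hsN : Tendsto (fun n : ℕ => (n : ℝ) * t n / m n) atTop (𝓝 0) := by
      have := ht0.div hmn hratio.ne'
      rw [zero_div] at this
      refine this.congr' ?_
      filter_upwards [hn, hm0] with n hn hm0
      have : (m n : ℝ) ≠ 0 := Nat.cast_ne_zero.2 hm0.ne'
      simp only [Pi.div_apply]
      field_simp
    exact tendsto_log_headSum_tailSum_tensor_tpow (M := fun n => n) (K := fun n => K n x)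
      hq hf hflat hVq hm0 hs hsN hu (tendsto_const_nhds (x := x)) hv'
      (Eventually.of_forall fun n => by rw [hK, mul_assoc x])
  have hP : ∀ x : ℝ, _ := fun x => by
    have hv' : Tendsto (fun n : ℕ => ((n : ℝ) * t n) ^ 2 / (n * entV p) / ((n : ℝ) * t n ^ 2))
        atTop (𝓝 (1 / entV p)) := by
      refine tendsto_const_nhds.congr' ?_
      filter_upwards [hn, hs] with n hn hs
      have : t n ≠ 0 := (pos_of_mul_pos_right hs hn.le).ne'
      field_simp
    have hu : Tendsto (fun n : ℕ => ((n : ℝ) * t n) ^ 2 / (n * entV p)) atTop atTop := by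
      refine (hv'.pos_mul_atTop (by positivity) hv).congr' ?_
      filter_upwards [hv.eventually_gt_atTop 0] with n h
      exact div_mul_cancel₀ _ h.ne'
    have hsN : Tendsto (fun n : ℕ => (n : ℝ) * t n / n) atTop (𝓝 0) := by
      refine ht0.congr' ?_
      filter_upwards [hn] with n hn
      field_simp
    have hy : Tendsto (fun n : ℕ => x - μ +
        ((n : ℝ) * ((E + μ * t n) / D) - m n) * D / ((n : ℝ) * t n)) atTop (𝓝 (x - μ)) := by
      have h0 : Tendsto (fun n : ℕ => ((n : ℝ) * ((E + μ * t n) / D) - m n) * D / ((n : ℝ) * t n))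
          atTop (𝓝 0) := by
        refine squeeze_zero_norm' ?_ (hst.const_div_atTop |D|)
        filter_upwards [hs, hfloor] with n hs h
        rw [norm_div, norm_mul, Real.norm_of_nonneg h.1, Real.norm_of_nonneg hs.le, Real.norm_eq_abs]
        refine div_le_div_of_nonneg_right ?_ hs.le
        exact mul_le_of_le_one_left (abs_nonneg D) h.2
      simpa using h0.const_add (x - μ)
    refine tendsto_log_headSum_tailSum_tensor_tpow (N := fun n => n) (M := m)
      (K := fun n => K n x) hp hf hflat hVp (eventually_gt_atTop 0) hs hsN hu hy hv' ?_
    filter_upwards [hs] with n hs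
    rw [hK, add_mul, div_mul_cancel₀ _ hs.ne', sub_mul, sub_mul, mul_assoc (n : ℝ) (_ / D), div_mul_cancel₀ _ hD]
    congr 1
    rw [hDdef, hEdef]
    ring
  have hQlim : ∀ x : ℝ, -(x ^ 2 / 2) * ((E / D)⁻¹ / entV q) = -(ν * x ^ 2) / (2 * entV p) := by
    intro x
    rw [hν]
    field_simp
  have hPlim : ∀ x : ℝ, -((x - μ) ^ 2 / 2) * (1 / entV p) = -(x - μ) ^ 2 / (2 * entV p) := by
    intro x
    field_simp
  refine ⟨fun x hx => ?_, fun x hx => ?_, fun x hx => ?_, fun x hx => ?_⟩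
  · rw [← hQlim]; exact (hQ x).1 hx
  · rw [← hQlim]; exact (hQ x).2 hx
  · rw [← hPlim]; exact (hP x).1 (sub_nonpos.2 hx)
  · rw [← hPlim]; exact (hP x).2 (sub_nonneg.2 hx)
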